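/- Let 2 < p < 6 and β = (p−2)/(6−p). Let I(1) < 0 be the infimum of E_NLS(u) = (1/2)∫_ℝ |u′|² dx − (1/p)∫_ℝ |u|^p dx over u ∈ H¹(ℝ) with ∫_ℝ |u|² dx = 1. Then for every μ > 0, the infimum over all v : [0,∞) → ℝ in H¹(ℝ⁺) with ∫_0^∞ |v|² dx = μ of the half-line NLS energy (1/2)∫_0^∞ |v′|² dx − (1/p)∫_0^∞ |v|^p dx equals 2^{2β} μ^{2β+1} · I(1). Equivalently, with θ = −I(1) > 0, the minimum on the half-line at mass μ equals −θ 2^{2β} μ^{2β+1}. -/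

import Mathlib

open MeasureTheory

/-- `u ∈ H¹(ℝ)` with (everywhere) derivative `u'`. -/
def InH1 (u u' : ℝ → ℝ) : Prop :=
  Continuous u ∧ Integrable (fun x => (u x) ^ 2) ∧
    (∀ x : ℝ, HasDerivAt u (u' x) x) ∧ Integrable (fun x => (u' x) ^ 2)

/-- The NLS energy on the line. -/
noncomputable def ENLS (p : ℝ) (u u' : ℝ → ℝ) : ℝ :=
  (1 / 2) * (∫ x : ℝ, (u' x) ^ 2) - (1 / p) * ∫ x : ℝ, |u x| ^ p

/-- `I(μ)` on the line. -/
noncomputable def Ilevel (p μ : ℝ) : ℝ :=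
  sInf {E : ℝ | ∃ u u' : ℝ → ℝ, InH1 u u' ∧ (∫ x : ℝ, (u x) ^ 2) = μ ∧ E = ENLS p u u'}

/-- `v ∈ H¹(ℝ⁺)` with derivative `v'` on `[0,∞)`. -/
def InH1Half (v v' : ℝ → ℝ) : Prop :=
  ContinuousOn v (Set.Ici 0) ∧ IntegrableOn (fun x => (v x) ^ 2) (Set.Ioi 0) ∧
    (∀ x ∈ Set.Ici (0 : ℝ), HasDerivWithinAt v (v' x) (Set.Ici 0) x) ∧
    IntegrableOn (fun x => (v' x) ^ 2) (Set.Ioi 0)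

/-- The NLS energy on the half-line. -/
noncomputable def ENLSHalf (p : ℝ) (v v' : ℝ → ℝ) : ℝ :=
  (1 / 2) * (∫ x in Set.Ioi (0 : ℝ), (v' x) ^ 2) -
    (1 / p) * ∫ x in Set.Ioi (0 : ℝ), |v x| ^ p


open Set Filter Topology

lemma hl_pow_bound {p a M : ℝ} (hp : 2 < p) (h : |a| ≤ M) : |a| ^ p ≤ M ^ (p - 2) * a ^ 2 := by
  have h1 : |a| ^ p = |a| ^ (p - 2) * a ^ 2 := by
    have : p = (p - 2) + 2 := by ring
    conv_lhs => rw [this]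
    rw [Real.rpow_add_of_nonneg (abs_nonneg a) (by linarith) (by norm_num)]
    norm_num
  rw [h1]
  exact mul_le_mul_of_nonneg_right
    (Real.rpow_le_rpow (abs_nonneg a) h (by linarith)) (sq_nonneg a)

lemma hl_half_bdd {v v' : ℝ → ℝ} (h : InH1Half v v') : ∃ M, 0 ≤ M ∧ ∀ x ∈ Ici (0:ℝ), |v x| ≤ M := by
  obtain ⟨hc, h2, hd, hd2⟩ := h
  have hda : ∀ x ∈ Ioi (0:ℝ), HasDerivAt v (v' x) x := fun x hx =>
    (hd x (Ioi_subset_Ici_self hx)).hasDerivAt (Ici_mem_nhds hx)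
  have hmeas : AEStronglyMeasurable v' (volume.restrict (Ioi 0)) := by
    have : AEStronglyMeasurable (deriv v) (volume.restrict (Ioi 0)) :=
      (measurable_deriv v).aestronglyMeasurable
    refine this.congr ?_
    filter_upwards [ae_restrict_mem measurableSet_Ioi] with x hx
    exact (hda x hx).deriv
  have hvmeas : AEStronglyMeasurable v (volume.restrict (Ioi 0)) :=
    (hc.mono Ioi_subset_Ici_self).aestronglyMeasurable measurableSet_Ioi
  have hint : IntegrableOn (fun x => 2 * v x * v' x) (Ioi 0) := by
    refine Integrable.mono' (h2.add hd2) ((hvmeas.const_mul 2).mul hmeas) ?_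
    filter_upwards with x
    simp only [Real.norm_eq_abs, Pi.add_apply]
    rw [abs_le]
    constructor <;> nlinarith [sq_nonneg (v x + v' x), sq_nonneg (v x - v' x)]
  set C := ∫ x in Ioi (0:ℝ), |2 * v x * v' x|
  have hC : 0 ≤ C := integral_nonneg fun x => abs_nonneg _
  refine ⟨√(v 0 ^ 2 + C), Real.sqrt_nonneg _, fun x hx => ?_⟩
  apply Real.abs_le_sqrt
  have hx : 0 ≤ x := hx
  have ftc : ∫ y in (0:ℝ)..x, 2 * v y * v' y = v x ^ 2 - v 0 ^ 2 := by
    refine intervalIntegral.integral_eq_sub_of_hasDerivAt_of_le (f := fun y => v y ^ 2) hx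
      ((hc.mono Icc_subset_Ici_self).pow 2) ?_ ?_
    · intro y hy
      have := (hda y hy.1).pow 2
      convert! this using 1
      simp
    · rw [intervalIntegrable_iff_integrableOn_Ioc_of_le hx]
      exact hint.mono_set Ioc_subset_Ioi_self
  have : ∫ y in (0:ℝ)..x, 2 * v y * v' y ≤ C := by
    rw [intervalIntegral.integral_of_le hx]
    calc ∫ y in Ioc 0 x, 2 * v y * v' y ≤ ∫ y in Ioc 0 x, |2 * v y * v' y| := by
          refine integral_mono (hint.mono_set Ioc_subset_Ioi_self)
            (Integrable.abs (hint.mono_set Ioc_subset_Ioi_self)) fun y => le_abs_self _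
      _ ≤ C := setIntegral_mono_set (Integrable.abs hint) (by filter_upwards with y using abs_nonneg _)
          (LE.le.eventuallyLE Ioc_subset_Ioi_self)
  linarith

lemma hl_half_pint {p M : ℝ} (hp : 2 < p) {v : ℝ → ℝ} (hc : ContinuousOn v (Ici 0))
    (h2 : IntegrableOn (fun x => (v x) ^ 2) (Ioi 0)) (hM : ∀ x ∈ Ici (0:ℝ), |v x| ≤ M) :
    IntegrableOn (fun x => |v x| ^ p) (Ioi 0) := by
  refine Integrable.mono' (Integrable.const_mul h2 (M ^ (p - 2))) ?_ ?_
  · refine ContinuousOn.aestronglyMeasurable ?_ measurableSet_Ioi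
    exact ((hc.mono Ioi_subset_Ici_self).abs).rpow_const fun x _ => Or.inr (by linarith)
  · filter_upwards [ae_restrict_mem measurableSet_Ioi] with x hx
    rw [Real.norm_eq_abs, abs_of_nonneg (Real.rpow_nonneg (abs_nonneg _) _)]
    exact hl_pow_bound hp (hM x (Ioi_subset_Ici_self hx))

lemma hl_exps {p t : ℝ} (hp1 : 2 < p) (hp2 : p < 6) (ht : 0 < t) :
    ∃ a b : ℝ, 0 < a ∧ 0 < b ∧ a ^ 2 * b⁻¹ = t ∧
      (a * b) ^ 2 * b⁻¹ = t ^ (2 * ((p - 2) / (6 - p)) + 1) ∧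
      a ^ p * b⁻¹ = t ^ (2 * ((p - 2) / (6 - p)) + 1) := by
  set β := (p - 2) / (6 - p) with hβ
  have hb : β * (6 - p) = p - 2 := by rw [hβ]; field_simp [(by linarith : (6 - p) ≠ 0)]
  have h2 : (t ^ ((1 + β) / 2)) ^ 2 = t ^ (1 + β) := by
    rw [← Real.rpow_natCast, ← Real.rpow_mul ht.le]; congr 1; push_cast; ring
  refine ⟨t ^ ((1 + β) / 2), t ^ β, Real.rpow_pos_of_pos ht _, Real.rpow_pos_of_pos ht _, ?_, ?_, ?_⟩
  · rw [h2, ← Real.rpow_neg ht.le, ← Real.rpow_add ht]; simp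
  · rw [mul_pow, h2, ← Real.rpow_neg ht.le, sq, ← Real.rpow_add ht, ← Real.rpow_add ht,
      ← Real.rpow_add ht]; congr 1; ring
  · rw [← Real.rpow_mul ht.le, ← Real.rpow_neg ht.le, ← Real.rpow_add ht]; congr 1; linarith

lemma hl_half_scale {p t : ℝ} (hp1 : 2 < p) (hp2 : p < 6) (ht : 0 < t) {v v' : ℝ → ℝ}
    (h : InH1Half v v') : ∃ w w' : ℝ → ℝ, InH1Half w w' ∧
      (∫ x in Ioi (0:ℝ), w x ^ 2) = t * ∫ x in Ioi (0:ℝ), v x ^ 2 ∧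
      ENLSHalf p w w' = t ^ (2 * ((p - 2) / (6 - p)) + 1) * ENLSHalf p v v' := by
  obtain ⟨a, b, ha, hb, e1, e2, e3⟩ := hl_exps hp1 hp2 ht
  obtain ⟨hc, h2, hd, hd2⟩ := h
  have hmap : MapsTo (fun x => b * x) (Ici (0:ℝ)) (Ici 0) := fun x hx => mul_nonneg hb.le hx
  have I : ∀ f : ℝ → ℝ, ∫ x in Ioi (0:ℝ), f (b * x) = b⁻¹ * ∫ x in Ioi (0:ℝ), f x := by
    intro f
    have := integral_comp_mul_left_Ioi f 0 hb
    simpa using this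
  have J : ∀ f : ℝ → ℝ, IntegrableOn f (Ioi 0) → IntegrableOn (fun x => f (b * x)) (Ioi 0) := by
    intro f hf
    rw [integrableOn_Ioi_comp_mul_left_iff f 0 hb]
    simpa using hf
  refine ⟨fun x => a * v (b * x), fun x => a * b * v' (b * x), ⟨?_, ?_, ?_, ?_⟩, ?_, ?_⟩
  · exact continuousOn_const.mul (hc.comp (by fun_prop) hmap)
  · simp only [mul_pow]
    exact Integrable.const_mul (J (fun x => v x ^ 2) h2) _
  · intro x hx
    have h1 : HasDerivWithinAt (fun x => b * x) b (Ici 0) x := by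
      simpa using ((hasDerivAt_id x).const_mul b).hasDerivWithinAt
    have := ((hd (b * x) (hmap hx)).comp x h1 hmap).const_mul a
    convert! this using 1
    ring
  · simp only [mul_pow]
    exact Integrable.const_mul (J (fun x => v' x ^ 2) hd2) _
  · simp only [mul_pow]
    rw [integral_const_mul, I (fun x => v x ^ 2), ← mul_assoc, e1]
  · unfold ENLSHalf
    have s1 : ∫ x in Ioi (0:ℝ), (a * b * v' (b * x)) ^ 2 =
        t ^ (2 * ((p - 2) / (6 - p)) + 1) * ∫ x in Ioi (0:ℝ), v' x ^ 2 := by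
      rw [← e2, mul_assoc, ← I (fun x => v' x ^ 2), ← integral_const_mul]
      simp only [mul_pow]
    have s2 : ∫ x in Ioi (0:ℝ), |a * v (b * x)| ^ p =
        t ^ (2 * ((p - 2) / (6 - p)) + 1) * ∫ x in Ioi (0:ℝ), |v x| ^ p := by
      rw [← e3, mul_assoc, ← I (fun x => |v x| ^ p), ← integral_const_mul]
      simp only [abs_mul, abs_of_pos ha, Real.mul_rpow ha.le (abs_nonneg _)]
    rw [s1, s2]; ring

lemma hl_line_scale {p t : ℝ} (hp1 : 2 < p) (hp2 : p < 6) (ht : 0 < t) {v v' : ℝ → ℝ}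
    (h : InH1 v v') : ∃ w w' : ℝ → ℝ, InH1 w w' ∧
      (∫ x, w x ^ 2) = t * ∫ x, v x ^ 2 ∧
      ENLS p w w' = t ^ (2 * ((p - 2) / (6 - p)) + 1) * ENLS p v v' := by
  obtain ⟨a, b, ha, hb, e1, e2, e3⟩ := hl_exps hp1 hp2 ht
  obtain ⟨hc, h2, hd, hd2⟩ := h
  have I : ∀ f : ℝ → ℝ, ∫ x, f (b * x) = b⁻¹ * ∫ x, f x := by
    intro f
    rw [Measure.integral_comp_mul_left, abs_of_pos (inv_pos.2 hb), smul_eq_mul]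
  refine ⟨fun x => a * v (b * x), fun x => a * b * v' (b * x), ⟨?_, ?_, ?_, ?_⟩, ?_, ?_⟩
  · fun_prop
  · simp only [mul_pow]
    exact Integrable.const_mul (Integrable.comp_mul_left' h2 hb.ne') _
  · intro x
    have h1 : HasDerivAt (fun x => b * x) b x := by
      simpa using ((hasDerivAt_id x).const_mul b)
    have := ((hd (b * x)).comp x h1).const_mul a
    convert! this using 1
    ring
  · simp only [mul_pow]
    exact Integrable.const_mul (Integrable.comp_mul_left' hd2 hb.ne') _
  · simp only [mul_pow]
    rw [integral_const_mul, I (fun x => v x ^ 2), ← mul_assoc, e1]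
  · unfold ENLS
    have s1 : ∫ x, (a * b * v' (b * x)) ^ 2 =
        t ^ (2 * ((p - 2) / (6 - p)) + 1) * ∫ x, v' x ^ 2 := by
      rw [← e2, mul_assoc, ← I (fun x => v' x ^ 2), ← integral_const_mul]
      simp only [mul_pow]
    have s2 : ∫ x, |a * v (b * x)| ^ p =
        t ^ (2 * ((p - 2) / (6 - p)) + 1) * ∫ x, |v x| ^ p := by
      rw [← e3, mul_assoc, ← I (fun x => |v x| ^ p), ← integral_const_mul]
      simp only [abs_mul, abs_of_pos ha, Real.mul_rpow ha.le (abs_nonneg _)]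
    rw [s1, s2]; ring

lemma hl_even_integral {f : ℝ → ℝ} (he : ∀ x, f (-x) = f x) :
    ∫ x, f x = 2 * ∫ x in Ioi (0:ℝ), f x := by
  rw [← integral_comp_abs]
  congr 1; ext x
  rcases abs_cases x with ⟨h, _⟩ | ⟨h, _⟩ <;> rw [h]
  exact (he x).symm

lemma hl_even_integrable {f : ℝ → ℝ} (he : ∀ x, f (-x) = f x) (h : IntegrableOn f (Ioi 0)) :
    Integrable f := by
  rw [← integrableOn_univ, ← Iic_union_Ioi (a := (0:ℝ)), integrableOn_union]
  refine ⟨?_, h⟩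
  have h1 : IntegrableOn (fun x => f (-x)) (Iic 0) := by
    have := Iff.mpr integrableOn_Ici_iff_integrableOn_Ioi h
    exact IntegrableOn.comp_neg_Iic (by simpa using this)
  simpa [he] using h1

lemma hl_cauchy_int {ε : ℝ} (hε : 0 < ε) :
    IntegrableOn (fun x : ℝ => (1 + (ε⁻¹ * x) ^ 2)⁻¹) (Ioi 0) ∧
    ∫ x in Ioi (0:ℝ), (1 + (ε⁻¹ * x) ^ 2)⁻¹ = ε * (Real.pi / 2) := by
  have he : 0 < ε⁻¹ := inv_pos.2 hε
  constructor
  · exact (integrable_inv_one_add_sq.comp_mul_left' he.ne').integrableOn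
  · have := integral_comp_mul_left_Ioi (fun x : ℝ => (1 + x ^ 2)⁻¹) 0 he
    rw [this, mul_zero, integral_Ioi_inv_one_add_sq]
    simp

lemma hl_smooth {p : ℝ} (hp : 2 < p) {v v' : ℝ → ℝ} (h : InH1Half v v') :
    ∃ C : ℝ, 0 ≤ C ∧ ∀ ε : ℝ, 0 < ε → ∃ u u' : ℝ → ℝ, InH1 u u' ∧
      2 * (∫ x in Ioi (0:ℝ), v x ^ 2) ≤ (∫ x, u x ^ 2) ∧
      (∫ x, u x ^ 2) ≤ 2 * (∫ x in Ioi (0:ℝ), v x ^ 2) + C * ε ∧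
      ENLS p u u' ≤ 2 * ENLSHalf p v v' := by
  obtain ⟨M, hM0, hM⟩ := hl_half_bdd h
  obtain ⟨hc, h2, hd, hd2⟩ := h
  refine ⟨2 * (M ^ 2 * (Real.pi / 2)), by positivity, fun ε hε => ?_⟩
  set g : ℝ → ℝ := fun x => √(x ^ 2 + ε ^ 2) - ε with hg
  set g' : ℝ → ℝ := fun x => x / √(x ^ 2 + ε ^ 2) with hg'
  have hpos : ∀ x : ℝ, 0 < x ^ 2 + ε ^ 2 := fun x => by positivity
  have hspos : ∀ x : ℝ, 0 < √(x ^ 2 + ε ^ 2) := fun x => Real.sqrt_pos.2 (hpos x)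
  have hssq : ∀ x : ℝ, √(x ^ 2 + ε ^ 2) ^ 2 = x ^ 2 + ε ^ 2 := fun x => Real.sq_sqrt (hpos x).le
  have hgc : Continuous g := by fun_prop
  have hg'c : Continuous g' := by
    refine continuous_id.div (by fun_prop) fun x => (hspos x).ne'
  have hgd : ∀ x, HasDerivAt g (g' x) x := by
    intro x
    have h1 : HasDerivAt (fun x : ℝ => x ^ 2 + ε ^ 2) (2 * x) x := by
      simpa using (hasDerivAt_pow 2 x).add_const (ε ^ 2)
    have := (h1.sqrt (hpos x).ne').sub_const ε
    convert! this using 1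
    have := (hspos x).ne'
    simp only [hg']
    field_simp
  have hg0 : ∀ x, g x ∈ Ici (0:ℝ) := by
    intro x
    have : ε ≤ √(x ^ 2 + ε ^ 2) := Real.le_sqrt_of_sq_le (by nlinarith [sq_nonneg x])
    simp only [hg, mem_Ici]; linarith
  have hge : ∀ x, g (-x) = g x := by intro x; simp [hg]
  have hg'e : ∀ x, g' (-x) = - g' x := by intro x; simp [hg', neg_div]
  have hxs : ∀ x, x ≤ √(x ^ 2 + ε ^ 2) := fun x =>
    Real.le_sqrt_of_sq_le (by nlinarith [sq_nonneg ε])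
  have hg'1 : ∀ x, g' x ≤ 1 := fun x => (div_le_one (hspos x)).2 (hxs x)
  have hg'0 : ∀ x ∈ Ioi (0:ℝ), 0 ≤ g' x := fun x hx => div_nonneg (le_of_lt hx) (hspos x).le
  have hg'abs : ∀ x ∈ Ioi (0:ℝ), |g' x| = g' x := fun x hx => abs_of_nonneg (hg'0 x hx)
  have hg'2 : ∀ x ∈ Ioi (0:ℝ), 1 - g' x ≤ (1 + (ε⁻¹ * x) ^ 2)⁻¹ := by
    intro x hx
    have h1 : (1 + (ε⁻¹ * x) ^ 2)⁻¹ = 1 - g' x ^ 2 := by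
      simp only [hg', div_pow, hssq]
      have := (hpos x).ne'
      have : ε ^ 2 + x ^ 2 ≠ 0 := by rw [add_comm]; exact this
      field_simp
      ring
    rw [h1]
    nlinarith [hg'0 x hx, hg'1 x]
  have hinj : InjOn g (Ioi 0) := by
    intro x hx y hy hxy
    have h1 : √(x ^ 2 + ε ^ 2) = √(y ^ 2 + ε ^ 2) := by simpa [hg] using hxy
    have h2 : x ^ 2 = y ^ 2 := by have := hssq x; rw [h1, hssq] at this; linarith
    have hx : 0 < x := hx
    have hy : 0 < y := hy
    exact (pow_left_inj₀ hx.le hy.le two_ne_zero).1 h2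
  have himg : g '' Ioi 0 = Ioi 0 := by
    ext y
    constructor
    · rintro ⟨x, hx, rfl⟩
      have hx : 0 < x := hx
      have : ε < √(x ^ 2 + ε ^ 2) := Real.lt_sqrt_of_sq_lt (by nlinarith)
      simp only [hg, mem_Ioi]; linarith
    · intro hy
      have hy : 0 < y := hy
      have h0 : 0 < (y + ε) ^ 2 - ε ^ 2 := by nlinarith
      refine ⟨√((y + ε) ^ 2 - ε ^ 2), Real.sqrt_pos.2 h0, ?_⟩
      simp only [hg]
      rw [Real.sq_sqrt h0.le, sub_add_cancel, Real.sqrt_sq (by linarith)]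
      ring
  -- change of variables
  have cvI : ∀ F : ℝ → ℝ, ∫ x in Ioi (0:ℝ), g' x * F (g x) = ∫ x in Ioi (0:ℝ), F x := by
    intro F
    have := integral_image_eq_integral_abs_deriv_smul (measurableSet_Ioi (a := (0:ℝ)))
      (fun x _ => (hgd x).hasDerivWithinAt) hinj F
    rw [himg] at this
    rw [this]
    refine setIntegral_congr_fun measurableSet_Ioi fun x hx => ?_
    simp only [hg'abs x hx, smul_eq_mul]
  have cvi : ∀ F : ℝ → ℝ, IntegrableOn F (Ioi 0) →
      IntegrableOn (fun x => g' x * F (g x)) (Ioi 0) := by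
    intro F hF
    have := (integrableOn_image_iff_integrableOn_abs_deriv_smul (measurableSet_Ioi (a := (0:ℝ)))
      (fun x _ => (hgd x).hasDerivWithinAt) hinj F).1 (by rwa [himg])
    refine this.congr_fun (fun x hx => ?_) measurableSet_Ioi
    simp only [hg'abs x hx, smul_eq_mul]
  have huc : Continuous (fun x => v (g x)) :=
    hc.comp_continuous hgc hg0
  obtain ⟨kI, kV⟩ := hl_cauchy_int hε
  have hbd : ∀ x, v x ^ 2 ≤ M ^ 2 ∨ x < 0 := fun x => by
    rcases lt_or_ge x 0 with hx | hx
    · exact Or.inr hx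
    · exact Or.inl (by rw [← sq_abs]; exact pow_le_pow_left₀ (abs_nonneg _) (hM x hx) 2)
  have hbd : ∀ x, v (g x) ^ 2 ≤ M ^ 2 := fun x =>
    (hbd (g x)).resolve_right (not_lt.2 (hg0 x))
  have cv2 := cvi (fun x => v x ^ 2) h2
  have hdom := cv2.add (Integrable.const_mul kI (M ^ 2))
  have hpt : ∀ x ∈ Ioi (0:ℝ), v (g x) ^ 2 ≤ g' x * v (g x) ^ 2 + M ^ 2 * (1 + (ε⁻¹ * x) ^ 2)⁻¹ := by
    intro x hx
    have h1 : v (g x) ^ 2 * (1 - g' x) ≤ M ^ 2 * (1 + (ε⁻¹ * x) ^ 2)⁻¹ :=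
      mul_le_mul (hbd x) (hg'2 x hx) (by linarith [hg'1 x]) (by positivity)
    linarith
  have hu2 : IntegrableOn (fun x => v (g x) ^ 2) (Ioi 0) := by
    refine Integrable.mono' hdom (huc.pow 2).aestronglyMeasurable ?_
    filter_upwards [ae_restrict_mem measurableSet_Ioi] with x hx
    rw [Real.norm_eq_abs, abs_of_nonneg (sq_nonneg _)]
    exact hpt x hx
  have cvd := cvi (fun x => v' x ^ 2) hd2
  have hud2 : IntegrableOn (fun x => (v' (g x) * g' x) ^ 2) (Ioi 0) := by
    have h1 : IntegrableOn (fun x => g' x * (g' x * v' (g x) ^ 2)) (Ioi 0) := by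
      refine Integrable.bdd_mul (c := 1) cvd hg'c.aestronglyMeasurable ?_
      filter_upwards [ae_restrict_mem measurableSet_Ioi] with x hx
      rw [Real.norm_eq_abs, hg'abs x hx]; exact hg'1 x
    refine h1.congr_fun (fun x _ => ?_) measurableSet_Ioi
    simp only; ring
  have hpI : IntegrableOn (fun x => |v (g x)| ^ p) (Ioi 0) :=
    hl_half_pint hp (v := fun x => v (g x)) huc.continuousOn hu2 fun x _ => hM (g x) (hg0 x)
  have hpv := cvi (fun x => |v x| ^ p) (hl_half_pint hp hc h2 hM)
  have ev2 : ∀ x, v (g (-x)) ^ 2 = v (g x) ^ 2 := fun x => by rw [hge]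
  have evp : ∀ x, |v (g (-x))| ^ p = |v (g x)| ^ p := fun x => by rw [hge]
  have evd : ∀ x, (v' (g (-x)) * g' (-x)) ^ 2 = (v' (g x) * g' x) ^ 2 := fun x => by
    rw [hge, hg'e]; ring
  refine ⟨fun x => v (g x), fun x => v' (g x) * g' x, ⟨huc, ?_, ?_, ?_⟩, ?_, ?_, ?_⟩
  · exact hl_even_integrable ev2 hu2
  · intro x
    have := (hd (g x) (hg0 x)).comp x (hgd x).hasDerivWithinAt (s := univ) (fun y _ => hg0 y)
    exact hasDerivWithinAt_univ.1 this
  · exact hl_even_integrable evd hud2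
  · rw [hl_even_integral ev2, ← cvI (fun x => v x ^ 2)]
    refine mul_le_mul_of_nonneg_left (setIntegral_mono_on cv2 hu2 measurableSet_Ioi ?_) zero_le_two
    intro x hx
    exact mul_le_of_le_one_left (sq_nonneg _) (hg'1 x)
  · rw [hl_even_integral ev2, ← cvI (fun x => v x ^ 2)]
    have := setIntegral_mono_on hu2 hdom measurableSet_Ioi hpt
    simp only [Pi.add_apply] at this
    rw [integral_add cv2 (Integrable.const_mul kI (M ^ 2)), integral_const_mul, kV] at this
    linarith
  · unfold ENLS ENLSHalf
    rw [hl_even_integral evd, hl_even_integral evp]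
    have a1 : ∫ x in Ioi (0:ℝ), (v' (g x) * g' x) ^ 2 ≤ ∫ x in Ioi (0:ℝ), v' x ^ 2 := by
      rw [← cvI (fun x => v' x ^ 2)]
      refine setIntegral_mono_on hud2 cvd measurableSet_Ioi fun x hx => ?_
      have : (v' (g x) * g' x) ^ 2 = g' x * (g' x * v' (g x) ^ 2) := by ring
      rw [this]
      exact mul_le_of_le_one_left (mul_nonneg (hg'0 x hx) (sq_nonneg _)) (hg'1 x)
    have a2 : ∫ x in Ioi (0:ℝ), |v x| ^ p ≤ ∫ x in Ioi (0:ℝ), |v (g x)| ^ p := by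
      rw [← cvI (fun x => |v x| ^ p)]
      refine setIntegral_mono_on hpv hpI measurableSet_Ioi fun x hx => ?_
      exact mul_le_of_le_one_left (Real.rpow_nonneg (abs_nonneg _) _) (hg'1 x)
    have a3 : (1 / p) * ∫ x in Ioi (0:ℝ), |v x| ^ p ≤ (1 / p) * ∫ x in Ioi (0:ℝ), |v (g x)| ^ p :=
      mul_le_mul_of_nonneg_left a2 (by positivity)
    linarith

lemma hl_restrict {u u' : ℝ → ℝ} (h : InH1 u u') : InH1Half u u' := by
  obtain ⟨hc, h2, hd, hd2⟩ := h
  exact ⟨hc.continuousOn, h2.integrableOn, fun x _ => (hd x).hasDerivWithinAt, hd2.integrableOn⟩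

lemma hl_neg {u u' : ℝ → ℝ} (h : InH1 u u') : InH1 (fun x => u (-x)) (fun x => - u' (-x)) := by
  obtain ⟨hc, h2, hd, hd2⟩ := h
  refine ⟨by fun_prop, h2.comp_neg, fun x => ?_, ?_⟩
  · have := (hd (-x)).comp x (hasDerivAt_neg x)
    convert! this using 1
    simp
  · simpa using hd2.comp_neg

lemma hl_shift {u u' : ℝ → ℝ} (h : InH1 u u') (c : ℝ) :
    InH1 (fun x => u (c + x)) (fun x => u' (c + x)) := by
  obtain ⟨hc, h2, hd, hd2⟩ := h
  refine ⟨by fun_prop, h2.comp_add_left c, fun x => ?_, hd2.comp_add_left c⟩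
  exact HasDerivAt.comp_const_add c x (hd (c + x))

lemma hl_split_int {f : ℝ → ℝ} (h1 : IntegrableOn f (Ioi 0))
    (h2 : IntegrableOn (fun x => f (-x)) (Ioi 0)) :
    ∫ x, f x = (∫ x in Ioi (0:ℝ), f (-x)) + ∫ x in Ioi (0:ℝ), f x := by
  have h3 : IntegrableOn f (Iic 0) := by
    have h2' := Iff.mpr integrableOn_Ici_iff_integrableOn_Ioi h2
    have : IntegrableOn (fun x => f (- -x)) (Iic 0) :=
      IntegrableOn.comp_neg_Iic (f := fun x => f (-x)) (by simpa using h2')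
    simpa using this
  rw [integral_comp_neg_Ioi, neg_zero, ← setIntegral_union (Iic_disjoint_Ioi le_rfl)
    measurableSet_Ioi h3 h1, Iic_union_Ioi, Measure.restrict_univ]

lemma hl_split {p : ℝ} (hp : 2 < p) {u u' : ℝ → ℝ} (h : InH1 u u') (hm : ∫ x, u x ^ 2 = 1) :
    ∃ v v' : ℝ → ℝ, InH1Half v v' ∧ (∫ x in Ioi (0:ℝ), v x ^ 2) = 1 / 2 ∧
      ENLSHalf p v v' ≤ ENLS p u u' / 2 := by
  obtain ⟨c, hcc⟩ : ∃ c : ℝ, ∫ x in Iic c, u x ^ 2 = 1 / 2 := by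
    have hi := h.2.1
    have hsum : (∫ x in Iic (0:ℝ), u x ^ 2) + ∫ x in Ioi (0:ℝ), u x ^ 2 = 1 := by
      rw [← setIntegral_union (Iic_disjoint_Ioi le_rfl) measurableSet_Ioi hi.integrableOn
        hi.integrableOn, Iic_union_Ioi, Measure.restrict_univ, hm]
    have hF : Continuous fun b => ∫ x in (0:ℝ)..b, u x ^ 2 :=
      intervalIntegral.continuous_primitive (fun a b => hi.intervalIntegrable) 0
    have ht := intervalIntegral_tendsto_integral_Ioi 0 hi.integrableOn tendsto_id
    have hb := (intervalIntegral_tendsto_integral_Iic 0 hi.integrableOn tendsto_id).neg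
    obtain ⟨c, hc⟩ := mem_range_of_exists_le_of_exists_ge (c := 1 / 2 - ∫ x in Iic (0:ℝ), u x ^ 2) hF
      (by
        obtain ⟨a, ha⟩ := (hb.eventually_le_const
          (show _ < 1 / 2 - ∫ x in Iic (0:ℝ), u x ^ 2 by linarith)).exists
        exact ⟨a, by rw [intervalIntegral.integral_symm]; exact ha⟩)
      ((ht.eventually_const_le (show 1 / 2 - ∫ x in Iic (0:ℝ), u x ^ 2 < _ by linarith)).exists)
    refine ⟨c, ?_⟩
    have := intervalIntegral.integral_Iic_sub_Iic (a := 0) (b := c) (f := fun x => u x ^ 2)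
      (μ := volume) hi.integrableOn hi.integrableOn
    simp only at hc
    linarith
  have hw := hl_shift h c
  set w := fun x => u (c + x) with hwd
  set w' := fun x => u' (c + x) with hwd'
  have R := hl_restrict hw
  have L := hl_restrict (hl_neg hw)
  obtain ⟨M1, -, hM1⟩ := hl_half_bdd R
  obtain ⟨M2, -, hM2⟩ := hl_half_bdd L
  have Rp := hl_half_pint hp R.1 R.2.1 hM1
  have Lp := hl_half_pint hp L.1 L.2.1 hM2
  have Em : (∫ x in Ioi (0:ℝ), w (-x) ^ 2) + ∫ x in Ioi (0:ℝ), w x ^ 2 = 1 := by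
    rw [← hl_split_int (f := fun x => w x ^ 2) R.2.1 L.2.1, ← hm]
    exact integral_add_left_eq_self (fun x => u x ^ 2) c
  have Ed : (∫ x in Ioi (0:ℝ), (- w' (-x)) ^ 2) + ∫ x in Ioi (0:ℝ), w' x ^ 2 = ∫ x, u' x ^ 2 := by
    have L4 := L.2.2.2
    simp only [neg_sq] at L4 ⊢
    rw [← hl_split_int (f := fun x => w' x ^ 2) R.2.2.2 L4]
    exact integral_add_left_eq_self (fun x => u' x ^ 2) c
  have Ep : (∫ x in Ioi (0:ℝ), |w (-x)| ^ p) + ∫ x in Ioi (0:ℝ), |w x| ^ p = ∫ x, |u x| ^ p := by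
    rw [← hl_split_int (f := fun x => |w x| ^ p) Rp Lp]
    exact integral_add_left_eq_self (fun x => |u x| ^ p) c
  have EL : (∫ x in Ioi (0:ℝ), w (-x) ^ 2) = 1 / 2 := by
    rw [integral_comp_neg_Ioi 0 (fun x => w x ^ 2), neg_zero, ← hcc]
    have := (measurePreserving_add_left volume c).setIntegral_preimage_emb
      (measurableEmbedding_addLeft c) (fun x => u x ^ 2) (Iic c)
    rw [← this]
    simp [hwd]
  have EE : ENLSHalf p (fun x => w (-x)) (fun x => - w' (-x)) + ENLSHalf p w w' = ENLS p u u' := by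
    unfold ENLSHalf ENLS
    rw [← Ed, ← Ep]; ring
  rcases le_total (ENLSHalf p (fun x => w (-x)) (fun x => - w' (-x))) (ENLSHalf p w w') with hle | hle
  · exact ⟨_, _, L, EL, by linarith⟩
  · exact ⟨_, _, R, by linarith, by linarith⟩

/-- Lemma 2, half-line part: the NLS ground-state level on `ℝ⁺` at mass `μ`
equals `2^{2β} μ^{2β+1} I(1)`, i.e. `−θ 2^{2β} μ^{2β+1}` with `θ = −I(1)`. -/
theorem halfline_ground_state (p : ℝ) (hp1 : 2 < p) (hp2 : p < 6)
    (hI : Ilevel p 1 < 0) :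
    ∀ μ : ℝ, 0 < μ →
      sInf {E : ℝ | ∃ v v' : ℝ → ℝ, InH1Half v v' ∧
          (∫ x in Set.Ioi (0 : ℝ), (v x) ^ 2) = μ ∧ E = ENLSHalf p v v'}
        = 2 ^ (2 * ((p - 2) / (6 - p))) *
            μ ^ (2 * ((p - 2) / (6 - p)) + 1) * Ilevel p 1 := by
  intro μ hμ
  set q := 2 * ((p - 2) / (6 - p)) + 1 with hq
  have hq0 : 0 < q := by
    have : 0 < (p - 2) / (6 - p) := div_pos (by linarith) (by linarith)
    linarith
  have hconst : (2:ℝ) ^ (2 * ((p - 2) / (6 - p))) * μ ^ q = (2 * μ) ^ q / 2 := by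
    rw [Real.mul_rpow zero_le_two hμ.le]
    have : (2:ℝ) ^ q = 2 ^ (2 * ((p - 2) / (6 - p))) * 2 := by
      rw [hq, Real.rpow_add zero_lt_two, Real.rpow_one]
    rw [this]; ring
  rw [hconst]
  have hcpos : 0 < (2 * μ) ^ q / 2 := by positivity
  set S := {E : ℝ | ∃ u u' : ℝ → ℝ, InH1 u u' ∧ (∫ x : ℝ, (u x) ^ 2) = 1 ∧ E = ENLS p u u'} with hS
  have hIS : Ilevel p 1 = sInf S := rfl
  have hne : S.Nonempty := by
    by_contra hcon
    rw [not_nonempty_iff_eq_empty] at hcon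
    rw [hIS, hcon, Real.sInf_empty] at hI
    exact lt_irrefl _ hI
  have hbb : BddBelow S := by
    by_contra hcon
    rw [hIS, Real.sInf_of_not_bddBelow hcon] at hI
    exact lt_irrefl _ hI
  -- upper bound
  have up : ∀ E ∈ S, ∃ F ∈ {E : ℝ | ∃ v v' : ℝ → ℝ, InH1Half v v' ∧
      (∫ x in Set.Ioi (0 : ℝ), (v x) ^ 2) = μ ∧ E = ENLSHalf p v v'},
      F ≤ (2 * μ) ^ q / 2 * E := by
    rintro E ⟨u, u', hu, hm, rfl⟩
    obtain ⟨v, v', hv, hvm, hvE⟩ := hl_split hp1 hu hm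
    obtain ⟨w, w', hw, hwm, hwE⟩ := hl_half_scale hp1 hp2 (t := 2 * μ) (by linarith) hv
    refine ⟨_, ⟨w, w', hw, by rw [hwm, hvm]; ring, rfl⟩, ?_⟩
    rw [hwE]
    have := mul_le_mul_of_nonneg_left hvE (by positivity : 0 ≤ (2 * μ) ^ q)
    linarith
  -- lower bound
  have low : ∀ F ∈ {E : ℝ | ∃ v v' : ℝ → ℝ, InH1Half v v' ∧
      (∫ x in Set.Ioi (0 : ℝ), (v x) ^ 2) = μ ∧ E = ENLSHalf p v v'},
      (2 * μ) ^ q / 2 * Ilevel p 1 ≤ F := by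
    rintro F ⟨v, v', hv, hvm, rfl⟩
    obtain ⟨C, hC, H⟩ := hl_smooth hp1 hv
    have key : ∀ ε > 0, (2 * μ + C * ε) ^ q * Ilevel p 1 ≤ 2 * ENLSHalf p v v' := by
      intro ε hε
      obtain ⟨u, u', hu, hm1, hm2, hE⟩ := H ε hε
      rw [hvm] at hm1 hm2
      set m := ∫ x, u x ^ 2 with hmd
      have hm : 0 < m := by linarith
      obtain ⟨w, w', hw, hwm, hwE⟩ := hl_line_scale hp1 hp2 (t := m⁻¹) (inv_pos.2 hm) hu
      have h1 : Ilevel p 1 ≤ ENLS p w w' := by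
        rw [hIS]
        exact csInf_le hbb ⟨w, w', hw, by rw [hwm, ← hmd]; exact inv_mul_cancel₀ hm.ne', rfl⟩
      rw [hwE, Real.inv_rpow hm.le] at h1
      have hmq : 0 < m ^ q := by positivity
      have h2 : m ^ q * Ilevel p 1 ≤ ENLS p u u' := by
        have := mul_le_mul_of_nonneg_left h1 hmq.le
        rwa [← mul_assoc, mul_inv_cancel₀ hmq.ne', one_mul] at this
      have h3 : m ^ q ≤ (2 * μ + C * ε) ^ q := Real.rpow_le_rpow hm.le hm2 hq0.le
      have h4 := mul_le_mul_of_nonpos_right h3 hI.le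
      linarith
    have hlim : Tendsto (fun ε : ℝ => (2 * μ + C * ε) ^ q * Ilevel p 1) (𝓝[>] 0)
        (𝓝 ((2 * μ) ^ q * Ilevel p 1)) := by
      have hcont : Continuous (fun ε : ℝ => (2 * μ + C * ε) ^ q * Ilevel p 1) :=
        (Continuous.rpow_const (by fun_prop) fun x => Or.inr hq0.le).mul continuous_const
      have := hcont.tendsto 0
      simp only [mul_zero, add_zero] at this
      exact this.mono_left nhdsWithin_le_nhds
    have := le_of_tendsto hlim (by
      filter_upwards [self_mem_nhdsWithin] with ε hε using key ε hε)
    linarith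
  apply le_antisymm
  · rw [mul_comm, ← div_le_iff₀ hcpos, hIS]
    refine le_csInf hne fun E hE => ?_
    obtain ⟨F, hF, hFE⟩ := up E hE
    rw [div_le_iff₀ hcpos, mul_comm]
    exact (csInf_le ⟨_, low⟩ hF).trans hFE
  · obtain ⟨E, hE⟩ := hne
    obtain ⟨F, hF, -⟩ := up E hE
    exact le_csInf ⟨F, hF⟩ low
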